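/- Let C be a natural number with C ≥ 2, let S : E → (Fin C → ℝ) be a map from a real normed vector space E such that for all u, v ∈ E and every coordinate j, |S(u) j − S(v) j| ≤ L_x * ‖u − v‖ (coordinate-wise Lipschitz with constant L_x ≥ 0). Fix x ∈ E and a class y : Fin C, and suppose the classification margin g(x) = S(x) y − max_{j ≠ y} S(x) j is positive. If r ≥ 0 satisfies L_x * r < g(x) / 2, then for every δ ∈ E with ‖δ‖ ≤ r and every j ≠ y, S(x + δ) y > S(x + δ) j; i.e., the predicted label at x + δ remains y. -/

import Mathlib

/-- Geometric implication (Proposition 3, Step 4): for logits that are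
coordinate-wise `L_x`-Lipschitz in the input, if the classification margin
`g(x) = S(x) y - max_{j ≠ y} S(x) j` is positive and `L_x * r < g(x) / 2`,
then every perturbation `δ` with `‖δ‖ ≤ r` leaves the predicted label `y`
unchanged. -/
theorem prediction_stable_of_margin
    {E : Type*} [NormedAddCommGroup E] [NormedSpace ℝ E]
    (C : ℕ) (hC : 2 ≤ C) (S : E → Fin C → ℝ)
    (L_x : ℝ) (hLx : 0 ≤ L_x)
    (hlip : ∀ u v : E, ∀ j : Fin C, |S u j - S v j| ≤ L_x * ‖u - v‖)
    (x : E) (y : Fin C)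
    (hmargin : 0 < S x y - (Finset.univ.erase y).sup'
      (by
        refine Finset.card_pos.mp ?_
        rw [Finset.card_erase_of_mem (Finset.mem_univ y), Finset.card_univ,
          Fintype.card_fin]
        omega) (S x))
    (r : ℝ) (hr : 0 ≤ r)
    (hrad : L_x * r < (S x y - (Finset.univ.erase y).sup'
      (by
        refine Finset.card_pos.mp ?_
        rw [Finset.card_erase_of_mem (Finset.mem_univ y), Finset.card_univ,
          Fintype.card_fin]
        omega) (S x)) / 2) :
    ∀ δ : E, ‖δ‖ ≤ r → ∀ j : Fin C, j ≠ y → S (x + δ) j < S (x + δ) y := by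
  intro δ hδ j hj
  have hmax := Finset.le_sup' (S x) (Finset.mem_erase.mpr ⟨hj, Finset.mem_univ j⟩)
  have hshift (i : Fin C) : |S (x + δ) i - S x i| ≤ L_x * r :=
    (hlip (x + δ) x i).trans <| by
      rw [add_sub_cancel_left]
      exact mul_le_mul_of_nonneg_left hδ hLx
  have hy := (abs_le.mp (hshift y)).1
  have hj := (abs_le.mp (hshift j)).2
  linarith
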